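/- arXiv:1802.07647 — 4 statements merged into one kernel-verified Lean document; each statement's English description precedes it below -/
import Mathlib

section
/- Residual sparsity of random-order Greedy (Lemma 1, safe constants). Let n ≥ 3, let G be a finite simple graph on n vertices, and let t be an integer with 1 ≤ t < n. If the greedy MIS process is run with a uniformly random ordering v_1, …, v_n of V, then with probability at least 1 − n^{−8}, the maximum degree of the residual graph satisfies Δ(G[U_t]) ≤ 10·ln(n)·n/t. -/
open Finset
open scoped Classical

/-- The closed neighborhood of `v` as a `Finset`. -/
def closedNbhd {V : Type*} [Fintype V] [DecidableEq V] (G : SimpleGraph V)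
    [DecidableRel G.Adj] (v : V) : Finset V :=
  insert v (G.neighborFinset v)

/-- One pass of the sequential greedy MIS process over a list of vertices, carrying
the pair `(I, U)` of the current independent set and the current uncovered set. -/
def greedyStep {V : Type*} [Fintype V] [DecidableEq V] (G : SimpleGraph V)
    [DecidableRel G.Adj] : Finset V × Finset V → List V → Finset V × Finset V
  | p, [] => p
  | p, v :: rest =>
      greedyStep G (if v ∈ p.2 then (insert v p.1, p.2 \ closedNbhd G v) else p) rest

/-- `greedyU G σ t` is `U_t`: the set of uncovered vertices at the beginning of
iteration `t` (i.e. after the greedy process has handled `v_1, …, v_{t-1}`). -/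
def greedyU {V : Type*} [Fintype V] [DecidableEq V] (G : SimpleGraph V)
    [DecidableRel G.Adj] {n : ℕ} (σ : Fin n ≃ V) (t : ℕ) : Finset V :=
  (greedyStep G (∅, Finset.univ) ((List.ofFn ⇑σ).take (t - 1))).2

/-- Maximum degree of the subgraph of `G` induced by the vertex set `S`. -/
def maxDegOn {V : Type*} [Fintype V] [DecidableEq V] (G : SimpleGraph V)
    [DecidableRel G.Adj] (S : Finset V) : ℕ :=
  S.sup fun v => (G.neighborFinset v ∩ S).card

section GreedyProcess

variable {V : Type*} [Fintype V] [DecidableEq V] (G : SimpleGraph V) [DecidableRel G.Adj] {n : ℕ}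

lemma greedyStep_append (p : Finset V × Finset V) (l l' : List V) :
    greedyStep G p (l ++ l') = greedyStep G (greedyStep G p l) l' := by
  induction l generalizing p with
  | nil => rfl
  | cons v l ih => exact ih _

lemma greedyU_one (σ : Fin n ≃ V) : greedyU G σ 1 = Finset.univ := by
  simp [greedyU, greedyStep]

lemma greedyU_succ (σ : Fin n ≃ V) (k : Fin n) :
    greedyU G σ (k + 1 + 1) =
      if σ k ∈ greedyU G σ (k + 1) then greedyU G σ (k + 1) \ closedNbhd G (σ k)
      else greedyU G σ (k + 1) := by
  have h : (List.ofFn ⇑σ).take (k + 1) = (List.ofFn ⇑σ).take k ++ [σ k] := by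
    rw [← List.take_concat_get' _ _ (by simp)]
    simp
  simp only [greedyU, Nat.add_sub_cancel, h, greedyStep_append]
  simp only [greedyStep]
  split_ifs <;> rfl

lemma greedyU_succ_subset (σ : Fin n ≃ V) (k : Fin n) :
    greedyU G σ (k + 1 + 1) ⊆ greedyU G σ (k + 1) := by
  rw [greedyU_succ]
  split_ifs
  · exact sdiff_subset
  · exact Subset.rfl

lemma notMem_greedyU (σ : Fin n ≃ V) {k : ℕ} (hk : k ≤ n) (j : Fin n) (hj : (j : ℕ) < k) :
    σ j ∉ greedyU G σ (k + 1) := by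
  induction k with
  | zero => omega
  | succ k ih =>
    intro hmem
    have hsub := greedyU_succ_subset G σ ⟨k, hk⟩ hmem
    obtain hlt | rfl := Nat.lt_succ_iff_lt_or_eq.mp hj
    · exact ih (by omega) hlt hsub
    · have hsucc := greedyU_succ G σ j
      rw [if_pos hsub] at hsucc
      rw [hsucc] at hmem
      simp [closedNbhd] at hmem

lemma greedyU_congr (σ τ : Fin n ≃ V) {k : ℕ} (hk : k ≤ n)
    (h : ∀ j : Fin n, (j : ℕ) < k → σ j = τ j) :
    greedyU G σ (k + 1) = greedyU G τ (k + 1) := by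
  induction k with
  | zero => simp [greedyU_one]
  | succ k ih =>
    have hσ := greedyU_succ G σ ⟨k, hk⟩
    have hτ := greedyU_succ G τ ⟨k, hk⟩
    simp only at hσ hτ
    rw [hσ, hτ, ih (by omega) fun j hj => h j (by omega), h ⟨k, hk⟩ (by simp)]

/-- The orderings for which, after `k` steps, `v` is uncovered with more than `D` uncovered
neighbors. -/
noncomputable def denseOrderings (n : ℕ) (v : V) (D : ℝ) (k : ℕ) : Finset (Fin n ≃ V) :=
  Finset.univ.filter fun σ =>
    v ∈ greedyU G σ (k + 1) ∧ D < (G.neighborFinset v ∩ greedyU G σ (k + 1)).card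

/-- The members of `denseOrderings` whose next vertex is an uncovered neighbor of `v`. -/
noncomputable def coveringOrderings (v : V) (D : ℝ) (k : Fin n) : Finset (Fin n ≃ V) :=
  (denseOrderings G n v D k).filter fun σ => σ k ∈ G.neighborFinset v ∩ greedyU G σ (k + 1)

lemma greedyU_swap (σ : Fin n ≃ V) {k : Fin n} {w : V} (hw : w ∈ greedyU G σ (k + 1)) :
    greedyU G ((Equiv.swap k (σ.symm w)).trans σ) (k + 1) = greedyU G σ (k + 1) := by
  refine greedyU_congr G _ _ k.isLt.le fun j hj => ?_
  have hjk : j ≠ k := by rintro rfl; exact lt_irrefl _ hj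
  have hjw : j ≠ σ.symm w := by
    rintro rfl
    exact notMem_greedyU G σ k.isLt.le _ hj (by simpa using hw)
  simp [Equiv.swap_apply_of_ne_of_ne hjk hjw]

/-- Swapping an uncovered neighbor of `v` into the next position shows that a random ordering
covers `v` next with probability at least `D / n`. -/
lemma mul_card_denseOrderings_le (v : V) (D : ℝ) (k : Fin n) :
    D * (denseOrderings G n v D k).card ≤ n * (coveringOrderings G v D k).card := by
  let P := (denseOrderings G n v D k).sigma fun σ => G.neighborFinset v ∩ greedyU G σ (k + 1)
  have hinj : P.card ≤ (coveringOrderings G v D k ×ˢ (Finset.univ : Finset (Fin n))).card := by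
    refine Finset.card_le_card_of_injOn
      (fun p => ((Equiv.swap k (p.1.symm p.2)).trans p.1, p.1.symm p.2)) ?_ ?_
    · rintro ⟨σ, w⟩ hp
      obtain ⟨hσ, hw⟩ := Finset.mem_sigma.mp hp
      have hU := greedyU_swap G σ (Finset.mem_inter.mp hw).2
      simp only [denseOrderings, Finset.mem_filter, Finset.mem_univ, true_and] at hσ
      simp only [Finset.coe_product, Finset.coe_univ, Set.mem_prod, Set.mem_univ, and_true,
        Finset.mem_coe, coveringOrderings, denseOrderings, Finset.mem_filter, Finset.mem_univ,
        true_and]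
      rw [hU]
      exact ⟨hσ, by simpa using hw⟩
    · rintro ⟨σ, w⟩ - ⟨τ, x⟩ - heq
      obtain ⟨h1, h2⟩ := Prod.mk.inj heq
      dsimp only at h1 h2
      rw [h2] at h1
      have hστ : σ = τ := by
        ext j
        have := DFunLike.congr_fun h1 (Equiv.swap k (τ.symm x) j)
        simpa using this
      subst hστ
      have := σ.symm.injective h2
      subst this
      rfl
  have hlow : D * (denseOrderings G n v D k).card ≤ P.card := by
    rw [Finset.card_sigma, Nat.cast_sum, mul_comm, ← nsmul_eq_mul]
    refine Finset.card_nsmul_le_sum _ _ _ fun σ hσ => ?_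
    exact (Finset.mem_filter.mp hσ).2.2.le
  rw [Finset.card_product, Finset.card_univ, Fintype.card_fin] at hinj
  calc D * (denseOrderings G n v D k).card ≤ P.card := hlow
    _ ≤ ((coveringOrderings G v D k).card * n : ℕ) := by exact_mod_cast hinj
    _ = n * (coveringOrderings G v D k).card := by push_cast; ring

lemma denseOrderings_succ_subset (v : V) (D : ℝ) (k : Fin n) :
    denseOrderings G n v D (k + 1) ⊆
      denseOrderings G n v D k \ coveringOrderings G v D k := by
  intro σ hσ
  obtain ⟨hv, hD⟩ := (Finset.mem_filter.mp hσ).2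
  have hsub := greedyU_succ_subset G σ k
  refine Finset.mem_sdiff.mpr ⟨Finset.mem_filter.mpr ⟨Finset.mem_univ _, hsub hv, ?_⟩, fun hc => ?_⟩
  · refine hD.trans_le ?_
    exact_mod_cast Finset.card_le_card (Finset.inter_subset_inter_left hsub)
  · obtain ⟨hadj, hmem⟩ := Finset.mem_inter.mp (Finset.mem_filter.mp hc).2
    rw [greedyU_succ, if_pos hmem] at hv
    refine (Finset.mem_sdiff.mp hv).2 (Finset.mem_insert_of_mem ?_)
    rw [SimpleGraph.mem_neighborFinset] at hadj ⊢
    exact hadj.symm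

lemma card_denseOrderings_succ_le (v : V) (D : ℝ) (k : Fin n) :
    ((denseOrderings G n v D (k + 1)).card : ℝ) ≤
      (1 - D / n) * (denseOrderings G n v D k).card := by
  have hn : (0 : ℝ) < n := by exact_mod_cast k.pos
  have hle := Finset.card_le_card (denseOrderings_succ_subset G v D k)
  have hcov : coveringOrderings G v D k ⊆ denseOrderings G n v D k := Finset.filter_subset _ _
  have hadd := Finset.card_sdiff_add_card_eq_card hcov
  have hsum : ((denseOrderings G n v D (k + 1)).card : ℝ) + (coveringOrderings G v D k).card ≤
      (denseOrderings G n v D k).card := by exact_mod_cast (by omega)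
  have hmul := mul_card_denseOrderings_le G v D k
  have hdiv : D / n * (denseOrderings G n v D k).card ≤ (coveringOrderings G v D k).card := by
    rw [div_mul_eq_mul_div, div_le_iff₀ hn]
    linarith
  linarith

lemma card_denseOrderings_le (v : V) {D : ℝ} (hD : D ≤ n) {k : ℕ} (hk : k ≤ n) :
    ((denseOrderings G n v D k).card : ℝ) ≤
      (1 - D / n) ^ k * Fintype.card (Fin n ≃ V) := by
  induction k with
  | zero =>
    rw [pow_zero, one_mul]
    exact_mod_cast Finset.card_le_univ _
  | succ k ih =>
    have hpos : 0 ≤ 1 - D / n := sub_nonneg.mpr (div_le_one_of_le₀ hD (Nat.cast_nonneg n))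
    calc ((denseOrderings G n v D (k + 1)).card : ℝ)
        ≤ (1 - D / n) * (denseOrderings G n v D k).card :=
          card_denseOrderings_succ_le G v D ⟨k, hk⟩
      _ ≤ (1 - D / n) * ((1 - D / n) ^ k * Fintype.card (Fin n ≃ V)) :=
          mul_le_mul_of_nonneg_left (ih (by omega)) hpos
      _ = (1 - D / n) ^ (k + 1) * Fintype.card (Fin n ≃ V) := by ring

lemma maxDegOn_le_iff (S : Finset V) {D : ℝ} (hD : 0 ≤ D) :
    (maxDegOn G S : ℝ) ≤ D ↔ ∀ v ∈ S, ((G.neighborFinset v ∩ S).card : ℝ) ≤ D := by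
  simp only [← Nat.le_floor_iff hD, maxDegOn, Finset.sup_le_iff]

end GreedyProcess

lemma one_sub_pow_le_zpow {n t : ℕ} (hn : 3 ≤ n) (ht : 10 ≤ t)
    (hD : 10 * Real.log n * n / t ≤ n) :
    (1 - 10 * Real.log n * n / t / n) ^ (t - 1) ≤ (n : ℝ) ^ (-9 : ℤ) := by
  have hn0 : (0 : ℝ) < n := by exact_mod_cast (by omega : 0 < n)
  have ht0 : (0 : ℝ) < t := by exact_mod_cast (by omega : 0 < t)
  have hlog : 0 ≤ Real.log n := Real.log_natCast_nonneg n
  have hpos : 0 ≤ 1 - 10 * Real.log n * n / t / n := sub_nonneg.mpr (div_le_one_of_le₀ hD hn0.le)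
  have ht' : ((t - 1 : ℕ) : ℝ) = t - 1 := by
    rw [Nat.cast_sub (by omega), Nat.cast_one]
  have ht10 : (10 : ℝ) ≤ t := by exact_mod_cast ht
  calc (1 - 10 * Real.log n * n / t / n) ^ (t - 1)
      ≤ Real.exp (-(10 * Real.log n * n / t / n)) ^ (t - 1) :=
        pow_le_pow_left₀ hpos (Real.one_sub_le_exp_neg _) _
    _ = Real.exp (-(10 * Real.log n * (t - 1) / t)) := by
        rw [← Real.exp_nat_mul, ht']
        congr 1
        field_simp
    _ ≤ Real.exp (Real.log n * (-9 : ℤ)) := by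
        refine Real.exp_le_exp.mpr ?_
        have : Real.log n * 9 ≤ 10 * Real.log n * (t - 1) / t := by
          rw [le_div_iff₀ ht0]
          nlinarith
        push_cast
        linarith
    _ = (n : ℝ) ^ (-9 : ℤ) := by
        rw [← Real.rpow_def_of_pos hn0, Real.rpow_intCast]

/-- **Residual sparsity of random-order Greedy.** With probability at least
`1 - n ^ (-8)` over a uniformly random ordering of the vertices, the residual graph
at the beginning of iteration `t` has maximum degree at most `10 · ln n · n / t`. -/
theorem residual_sparsity_random_order_greedy
    {V : Type*} [Fintype V] [DecidableEq V] {n : ℕ} (hn : 3 ≤ n)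
    (hcard : Fintype.card V = n)
    (G : SimpleGraph V) [DecidableRel G.Adj]
    (t : ℕ) (ht1 : 1 ≤ t) (htn : t < n) :
    (1 - (n : ℝ) ^ (-8 : ℤ)) * (Fintype.card (Fin n ≃ V) : ℝ) ≤
      ((Finset.univ.filter (fun σ : Fin n ≃ V =>
        (maxDegOn G (greedyU G σ t) : ℝ) ≤ 10 * Real.log n * n / t)).card : ℝ) := by
  have hn0 : (0 : ℝ) < n := by exact_mod_cast (by omega : 0 < n)
  have ht0 : (0 : ℝ) < t := by exact_mod_cast ht1
  have hD0 : 0 ≤ 10 * Real.log n * n / t := by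
    have := Real.log_natCast_nonneg n
    positivity
  set D := 10 * Real.log n * n / t with hD
  have hbad (v : V) : ((denseOrderings G n v D (t - 1)).card : ℝ) ≤
      (n : ℝ) ^ (-9 : ℤ) * Fintype.card (Fin n ≃ V) := by
    by_cases hDn : D < n
    · have hlog : 1 ≤ Real.log n := by
        rw [Real.le_log_iff_exp_le hn0]
        exact Real.exp_one_lt_three.le.trans (by exact_mod_cast hn)
      have ht : 10 ≤ t := by
        rw [hD, div_lt_iff₀ ht0] at hDn
        have : (10 : ℝ) ≤ t := by nlinarith
        exact_mod_cast this
      exact (card_denseOrderings_le G v hDn.le (by omega)).trans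
        (mul_le_mul_of_nonneg_right (one_sub_pow_le_zpow hn ht hDn.le) (Nat.cast_nonneg _))
    · have hempty : denseOrderings G n v D (t - 1) = ∅ := by
        refine Finset.filter_eq_empty_iff.mpr fun σ _ hσ => hDn (hσ.2.trans_le ?_)
        exact_mod_cast (Finset.card_le_univ _).trans_eq hcard
      rw [hempty, Finset.card_empty, Nat.cast_zero]
      positivity
  have hcover : (Finset.univ : Finset (Fin n ≃ V)) ⊆
      Finset.univ.filter (fun σ : Fin n ≃ V => (maxDegOn G (greedyU G σ t) : ℝ) ≤ D) ∪
        Finset.univ.biUnion fun v => denseOrderings G n v D (t - 1) := by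
    intro σ _
    by_cases h : (maxDegOn G (greedyU G σ t) : ℝ) ≤ D
    · exact Finset.mem_union_left _ (Finset.mem_filter.mpr ⟨Finset.mem_univ _, h⟩)
    · rw [maxDegOn_le_iff G _ hD0] at h
      push Not at h
      obtain ⟨v, hv, hlt⟩ := h
      refine Finset.mem_union_right _ (Finset.mem_biUnion.mpr ⟨v, Finset.mem_univ _, ?_⟩)
      rw [denseOrderings, Nat.sub_add_cancel ht1]
      exact Finset.mem_filter.mpr ⟨Finset.mem_univ _, hv, hlt⟩
  have hcount := (Finset.card_le_card hcover).trans ((Finset.card_union_le _ _).trans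
    (Nat.add_le_add_left Finset.card_biUnion_le _))
  rw [Finset.card_univ, ← Nat.cast_le (α := ℝ)] at hcount
  push_cast at hcount
  have hsum : ∑ v : V, ((denseOrderings G n v D (t - 1)).card : ℝ) ≤
      (n : ℝ) ^ (-8 : ℤ) * Fintype.card (Fin n ≃ V) := by
    calc ∑ v : V, ((denseOrderings G n v D (t - 1)).card : ℝ)
        ≤ ∑ _v : V, (n : ℝ) ^ (-9 : ℤ) * Fintype.card (Fin n ≃ V) :=
          Finset.sum_le_sum fun v _ => hbad v
      _ = (n : ℝ) ^ (1 + -9 : ℤ) * Fintype.card (Fin n ≃ V) := by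
          rw [Finset.sum_const, Finset.card_univ, hcard, nsmul_eq_mul, zpow_add₀ hn0.ne', zpow_one,
            mul_assoc]
      _ = (n : ℝ) ^ (-8 : ℤ) * Fintype.card (Fin n ≃ V) := by norm_num
  linarith
end

section
/- Chernoff bound for dependent variables (Theorem 3 of the paper). Suppose there exists p ∈ [0,1] such that for every k ∈ {1,…,m} and all a_1, …, a_{k−1} ∈ {0,1} with Pr[X_1 = a_1, …, X_{k−1} = a_{k−1}] > 0, one has Pr[X_k = 1 | X_1 = a_1, …, X_{k−1} = a_{k−1}] ≤ p. Let μ be a real number with μ ≥ p·m. Then for every δ > 0: Pr[Σ_{i=1}^m X_i ≥ (1+δ)·μ] ≤ (e^δ / (1+δ)^{1+δ})^μ. -/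
open MeasureTheory

/-- If each of the `{0, 1}`-valued variables `X k`, `k < m`, equals `1` with conditional probability
at most `q` given any outcome of its predecessors, then on a cylinder set fixing the first `k`
variables the product of `1 + d * X i` over the remaining ones has conditional mean at most
`(1 + d * q) ^ (m - k)`. -/
theorem setLIntegral_prod_one_add_mul_le {Ω : Type*} [MeasurableSpace Ω] (μ : Measure Ω)
    [IsFiniteMeasure μ] (m : ℕ) (X : ℕ → Ω → ℝ) (hXmeas : ∀ i, Measurable (X i))
    (hX01 : ∀ i, ∀ ω, X i ω = 0 ∨ X i ω = 1) (q d : ENNReal)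
    (hcond : ∀ k, k < m → ∀ a : ℕ → ℝ, (∀ i, a i = 0 ∨ a i = 1) →
      μ {ω | ∀ i, i < k → X i ω = a i} ≠ 0 →
      μ ({ω | X k ω = 1} ∩ {ω | ∀ i, i < k → X i ω = a i}) /
          μ {ω | ∀ i, i < k → X i ω = a i} ≤ q)
    (j k : ℕ) (hjk : k + j = m) (a : ℕ → ℝ) (ha : ∀ i, a i = 0 ∨ a i = 1) :
    ∫⁻ ω in {ω | ∀ i, i < k → X i ω = a i},
        ∏ i ∈ Finset.range j, (1 + d * ENNReal.ofReal (X (k + i) ω)) ∂μ ≤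
      (1 + d * q) ^ j * μ {ω | ∀ i, i < k → X i ω = a i} := by
  induction j generalizing k a with
  | zero => simp
  | succ j ih =>
    set C : Set Ω := {ω | ∀ i, i < k → X i ω = a i} with hC
    have hext (b : ℝ) : {ω | ∀ i, i < k + 1 → X i ω = Function.update a k b i} =
        {ω | X k ω = b} ∩ C := by
      ext ω
      simp only [Set.mem_ofPred_eq, Set.mem_inter_iff, hC, Nat.forall_lt_succ_right,
        Function.update_self]
      rw [and_comm]
      refine and_congr_right fun _ => forall₂_congr fun i hi => ?_
      rw [Function.update_of_ne hi.ne]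
    have hstep (b : ℝ) (hb : b = 0 ∨ b = 1) :
        ∫⁻ ω in {ω | X k ω = b} ∩ C,
            ∏ i ∈ Finset.range (j + 1), (1 + d * ENNReal.ofReal (X (k + i) ω)) ∂μ ≤
          (1 + d * q) ^ j * μ ({ω | X k ω = b} ∩ C) * (1 + d * ENNReal.ofReal b) := by
      have hmC : MeasurableSet ({ω | X k ω = b} ∩ C) := by
        rw [← hext]
        measurability
      have hb' : ∀ i, Function.update a k b i = 0 ∨ Function.update a k b i = 1 := by
        intro i
        rcases eq_or_ne i k with rfl | h
        · simpa using hb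
        · simpa [h] using ha i
      have hIH := ih (k + 1) (by omega) (Function.update a k b) hb'
      rw [hext] at hIH
      calc _ = ∫⁻ ω in {ω | X k ω = b} ∩ C,
            (∏ i ∈ Finset.range j, (1 + d * ENNReal.ofReal (X (k + 1 + i) ω))) *
              (1 + d * ENNReal.ofReal b) ∂μ := by
            refine setLIntegral_congr_fun hmC fun ω hω => ?_
            have h1 : X k ω = b := hω.1
            simp only [Finset.prod_range_succ', add_zero, h1, add_assoc, add_comm 1]
        _ = (∫⁻ ω in {ω | X k ω = b} ∩ C,
            ∏ i ∈ Finset.range j, (1 + d * ENNReal.ofReal (X (k + 1 + i) ω)) ∂μ) *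
              (1 + d * ENNReal.ofReal b) := lintegral_mul_const _ (by fun_prop)
        _ ≤ _ := by gcongr
    have hm1 : MeasurableSet {ω | X k ω = 1} := measurableSet_eq_fun (hXmeas k) measurable_const
    have hcompl : C \ {ω | X k ω = 1} = {ω | X k ω = 0} ∩ C := by
      ext ω
      rcases hX01 k ω with h | h <;> simp [h]
    have hsplit : μ ({ω | X k ω = 1} ∩ C) + μ ({ω | X k ω = 0} ∩ C) = μ C := by
      rw [← hcompl, Set.inter_comm]
      exact measure_inter_add_sdiff _ hm1
    have hq : μ ({ω | X k ω = 1} ∩ C) ≤ q * μ C := by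
      by_cases h0 : μ C = 0
      · simp [measure_mono_null Set.inter_subset_right h0]
      · exact (ENNReal.div_le_iff h0 (measure_ne_top μ C)).1 (hcond k (by omega) a ha h0)
    calc _ = _ := (lintegral_inter_add_sdiff _ C hm1).symm
      _ ≤ (1 + d * q) ^ j * μ ({ω | X k ω = 1} ∩ C) * (1 + d * ENNReal.ofReal 1) +
          (1 + d * q) ^ j * μ ({ω | X k ω = 0} ∩ C) * (1 + d * ENNReal.ofReal 0) := by
        rw [hcompl, Set.inter_comm C]
        exact add_le_add (hstep 1 (Or.inr rfl)) (hstep 0 (Or.inl rfl))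
      _ = (1 + d * q) ^ j * (μ C + d * μ ({ω | X k ω = 1} ∩ C)) := by
        rw [← hsplit]
        simp only [ENNReal.ofReal_one, ENNReal.ofReal_zero]
        ring
      _ ≤ (1 + d * q) ^ j * (μ C + d * (q * μ C)) := by gcongr
      _ = _ := by ring

/-- **Chernoff bound for dependent 0/1 random variables.** If each `X k` is `1`
with (conditional) probability at most `p`, conditioned on any outcome of the
previous variables, and `μ₀ ≥ p·m`, then for every `δ > 0` the sum `∑ X i`
exceeds `(1+δ)·μ₀` with probability at most `(e^δ / (1+δ)^{1+δ})^{μ₀}`. -/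
theorem chernoff_bound_dependent
    {Ω : Type*} [MeasurableSpace Ω] (μ : Measure Ω) [IsProbabilityMeasure μ]
    (m : ℕ) (X : ℕ → Ω → ℝ) (hXmeas : ∀ i, Measurable (X i))
    (hX01 : ∀ i, ∀ ω, X i ω = 0 ∨ X i ω = 1)
    (p : ℝ) (hp0 : 0 ≤ p) (hp1 : p ≤ 1)
    (hcond : ∀ k, k < m → ∀ a : ℕ → ℝ, (∀ i, a i = 0 ∨ a i = 1) →
      μ {ω | ∀ i, i < k → X i ω = a i} ≠ 0 →
      μ ({ω | X k ω = 1} ∩ {ω | ∀ i, i < k → X i ω = a i}) /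
          μ {ω | ∀ i, i < k → X i ω = a i} ≤ ENNReal.ofReal p)
    (μ₀ : ℝ) (hμ₀ : p * m ≤ μ₀) (δ : ℝ) (hδ : 0 < δ) :
    μ {ω | (1 + δ) * μ₀ ≤ ∑ i ∈ Finset.range m, X i ω} ≤
      ENNReal.ofReal ((Real.exp δ / (1 + δ) ^ (1 + δ)) ^ μ₀) := by
  have hμ0 : 0 ≤ μ₀ := le_trans (by positivity) hμ₀
  have h1δ : 0 < 1 + δ := by linarith
  have hmean := setLIntegral_prod_one_add_mul_le μ m X hXmeas hX01 (ENNReal.ofReal p)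
    (ENNReal.ofReal δ) hcond m 0 (zero_add m) 0 (fun _ => Or.inl rfl)
  simp only [not_lt_zero, false_imp_iff, implies_true, Set.ofPred_true, zero_add,
    Measure.restrict_univ, measure_univ, mul_one] at hmean
  have hprod (ω : Ω) : ∏ i ∈ Finset.range m, (1 + ENNReal.ofReal δ * ENNReal.ofReal (X i ω)) =
      ENNReal.ofReal ((1 + δ) ^ ∑ i ∈ Finset.range m, X i ω) := by
    rw [Real.rpow_sum_of_pos h1δ, ENNReal.ofReal_prod_of_nonneg fun i _ => by positivity]
    refine Finset.prod_congr rfl fun i _ => ?_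
    rcases hX01 i ω with h | h
    · simp [h]
    · simp [h, ENNReal.ofReal_add zero_le_one hδ.le]
  simp only [hprod] at hmean
  set A : ℝ := (1 + δ) ^ ((1 + δ) * μ₀) with hA
  have hApos : 0 < A := by positivity
  have hbound : (1 + ENNReal.ofReal δ * ENNReal.ofReal p) ^ m ≤
      ENNReal.ofReal (Real.exp (δ * μ₀)) := by
    rw [← ENNReal.ofReal_mul hδ.le, ← ENNReal.ofReal_one,
      ← ENNReal.ofReal_add zero_le_one (by positivity), ← ENNReal.ofReal_pow (by positivity)]
    refine ENNReal.ofReal_le_ofReal ?_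
    calc (1 + δ * p) ^ m ≤ Real.exp (δ * p) ^ m := by
          gcongr
          linarith [Real.add_one_le_exp (δ * p)]
      _ = Real.exp (δ * (p * m)) := by rw [← Real.exp_nat_mul]; ring_nf
      _ ≤ _ := by gcongr
  have hvalue : (Real.exp δ / (1 + δ) ^ (1 + δ)) ^ μ₀ = Real.exp (δ * μ₀) / A := by
    rw [Real.div_rpow (by positivity) (by positivity), ← Real.exp_mul, ← Real.rpow_mul h1δ.le]
  rw [hvalue, ENNReal.ofReal_div_of_pos hApos]
  calc _ ≤ μ {ω | ENNReal.ofReal A ≤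
          ENNReal.ofReal ((1 + δ) ^ ∑ i ∈ Finset.range m, X i ω)} := by
        refine measure_mono fun ω hω => ENNReal.ofReal_le_ofReal ?_
        exact Real.rpow_le_rpow_of_exponent_le (by linarith) hω
    _ ≤ _ := meas_ge_le_lintegral_div (by fun_prop) (by simpa using hApos) ENNReal.ofReal_ne_top
    _ ≤ _ := ENNReal.div_le_div_right (hmean.trans hbound) _
end

section
/- Intersection of a fixed set with a uniformly random sample without replacement (core of Lemma 3). Let n ≥ 2 be an integer, let W be a finite set with |W| = N ≤ n, let A ⊆ W with |A| = d, and let s ≥ 0 be an integer with N − s ≥ n/2. If S is a uniformly random s-element subset of W, then Pr[ |A ∩ S| ≥ max(18·d·s/N, 72·ln n) ] ≤ n^{−10}. -/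
theorem Nat.descFactorial_mul_pow_le {s N : ℕ} (h : s ≤ N) (k : ℕ) :
    s.descFactorial k * N ^ k ≤ s ^ k * N.descFactorial k := by
  induction k with
  | zero => simp
  | succ k ih =>
    have step : (s - k) * N ≤ s * (N - k) := by
      rw [Nat.sub_mul, Nat.mul_sub, Nat.mul_comm s k]
      exact Nat.sub_le_sub_left (Nat.mul_comm s k ▸ Nat.mul_le_mul_left k h) _
    calc s.descFactorial (k + 1) * N ^ (k + 1)
        = ((s - k) * N) * (s.descFactorial k * N ^ k) := by
          rw [Nat.descFactorial_succ]; ring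
      _ ≤ (s * (N - k)) * (s ^ k * N.descFactorial k) := Nat.mul_le_mul step ih
      _ = s ^ (k + 1) * N.descFactorial (k + 1) := by
          rw [Nat.descFactorial_succ]; ring

theorem Nat.choose_sub_mul_pow_le {s N k : ℕ} (h : s ≤ N) (hk : k ≤ s) :
    (N - k).choose (s - k) * N ^ k ≤ s ^ k * N.choose s := by
  have h1 : N.choose s * s.choose k = N.choose k * (N - k).choose (s - k) :=
    Nat.choose_mul hk
  have h2 := Nat.descFactorial_mul_pow_le h k
  rw [Nat.descFactorial_eq_factorial_mul_choose, Nat.descFactorial_eq_factorial_mul_choose] at h2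
  have h3 : s.choose k * N ^ k ≤ s ^ k * N.choose k := by
    refine Nat.le_of_mul_le_mul_left ?_ k.factorial_pos
    calc _ = k.factorial * s.choose k * N ^ k := by ring
      _ ≤ _ := h2
      _ = _ := by ring
  refine Nat.le_of_mul_le_mul_left ?_ (Nat.choose_pos (hk.trans h))
  calc N.choose k * ((N - k).choose (s - k) * N ^ k)
      = N.choose s * (s.choose k * N ^ k) := by rw [← mul_assoc, ← h1]; ring
    _ ≤ N.choose s * (s ^ k * N.choose k) := Nat.mul_le_mul_left _ h3
    _ = _ := by ring

theorem Finset.card_powersetCard_filter_superset_mul_pow_le {α : Type*} [DecidableEq α]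
    {W B : Finset α} (hB : B ⊆ W) {s : ℕ} (hs : s ≤ W.card) :
    ((W.powersetCard s).filter (fun S => B ⊆ S)).card * W.card ^ B.card
      ≤ s ^ B.card * W.card.choose s := by
  by_cases hk : B.card ≤ s
  · refine le_trans (Nat.mul_le_mul_right _ ?_) (Nat.choose_sub_mul_pow_le hs hk)
    rw [← Finset.card_sdiff_of_subset hB, ← Finset.card_powersetCard]
    refine Finset.card_le_card_of_injOn (fun S => S \ B) ?_ ?_
    · intro S hS
      simp only [Finset.coe_filter, Set.mem_ofPred_eq, Finset.mem_powersetCard] at hS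
      simp only [Finset.mem_coe, Finset.mem_powersetCard]
      exact ⟨Finset.sdiff_subset_sdiff hS.1.1 subset_rfl,
        by rw [Finset.card_sdiff_of_subset hS.2, hS.1.2]⟩
    · intro S hS T hT hST
      simp only [Finset.coe_filter, Set.mem_ofPred_eq] at hS hT
      rw [← Finset.sdiff_union_of_subset hS.2, ← Finset.sdiff_union_of_subset hT.2]
      exact congrArg (· ∪ B) hST
  · rw [Finset.filter_eq_empty_iff.2]
    · simp
    · intro S hS hBS
      exact hk ((Finset.card_le_card hBS).trans (Finset.mem_powersetCard.1 hS).2.le)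

theorem Finset.sum_powersetCard_two_pow_card_inter_le {α : Type*} [DecidableEq α]
    {W A : Finset α} (hA : A ⊆ W) {s : ℕ} (hs : s ≤ W.card) (hW : 0 < W.card) :
    ∑ S ∈ W.powersetCard s, (2 : ℝ) ^ (A ∩ S).card
      ≤ ((s : ℝ) / W.card + 1) ^ A.card * (W.card.choose s : ℝ) := by
  have hWpos : (0 : ℝ) < W.card := Nat.cast_pos.2 hW
  have hpow : ∀ S : Finset α, (2 : ℝ) ^ (A ∩ S).card
      = ∑ B ∈ A.powerset, if B ⊆ S then (1 : ℝ) else 0 := by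
    intro S
    rw [Finset.sum_boole]
    have : A.powerset.filter (fun B => B ⊆ S) = (A ∩ S).powerset := by
      ext B; simp only [Finset.mem_filter, Finset.mem_powerset, Finset.subset_inter_iff]
    rw [this, Finset.card_powerset]; push_cast; rfl
  simp_rw [hpow]
  rw [Finset.sum_comm, ← Finset.sum_pow_mul_eq_add_pow, Finset.sum_mul]
  refine Finset.sum_le_sum fun B hB => ?_
  rw [Finset.sum_boole, one_pow, mul_one, div_pow, div_mul_eq_mul_div, le_div_iff₀ (by positivity)]
  exact_mod_cast Finset.card_powersetCard_filter_superset_mul_pow_le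
    ((Finset.mem_powerset.1 hB).trans hA) hs

open scoped Classical

/-- **Intersection of a fixed set with a uniformly random sample without
replacement.** Let `W` be a set of `N ≤ n` elements, `A ⊆ W` with `|A| = d`, and
let `S` be a uniformly random `s`-element subset of `W`, where `N - s ≥ n/2`.
Then `|A ∩ S| ≥ max (18·d·s/N) (72·ln n)` with probability at most `n ^ (-10)`. -/
theorem random_sample_intersection_tail
    {α : Type*} [DecidableEq α] (n : ℕ) (hn : 2 ≤ n)
    (W : Finset α) (N : ℕ) (hW : W.card = N) (hNn : N ≤ n)
    (A : Finset α) (hAW : A ⊆ W) (d : ℕ) (hA : A.card = d)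
    (s : ℕ) (hs : (n : ℝ) / 2 ≤ (N : ℝ) - (s : ℝ)) :
    (((W.powersetCard s).filter (fun S =>
        max (18 * (d : ℝ) * s / N) (72 * Real.log n) ≤ ((A ∩ S).card : ℝ))).card : ℝ)
      ≤ (n : ℝ) ^ (-10 : ℤ) * ((W.powersetCard s).card : ℝ) := by
  subst hW hA
  have hn' : (2 : ℝ) ≤ n := by exact_mod_cast hn
  have hs' : s ≤ W.card := by
    have : (s : ℝ) ≤ W.card := by linarith
    exact_mod_cast this
  have hs0 : (0 : ℝ) ≤ s := Nat.cast_nonneg s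
  have hWpos : 0 < W.card := by
    have : (0 : ℝ) < W.card := by linarith
    exact_mod_cast this
  have hlog : 0 < Real.log n := Real.log_pos (by linarith)
  set T := max (18 * (A.card : ℝ) * s / W.card) (72 * Real.log n) with hT
  have hT1 : 18 * (A.card * ((s : ℝ) / W.card)) ≤ T :=
    le_trans (le_of_eq (by ring)) (le_max_left _ _)
  have hT2 : 72 * Real.log n ≤ T := le_max_right _ _
  set F := (W.powersetCard s).filter (fun S => T ≤ ((A ∩ S).card : ℝ)) with hF
  have hmarkov : (F.card : ℝ) * Real.exp (T / 2)
      ≤ ∑ S ∈ W.powersetCard s, (2 : ℝ) ^ (A ∩ S).card := by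
    rw [← nsmul_eq_mul]
    refine (Finset.card_nsmul_le_sum F _ _ fun S hS => ?_).trans
      (Finset.sum_le_sum_of_subset_of_nonneg (Finset.filter_subset _ _)
        fun _ _ _ => by positivity)
    have hTS : T ≤ ((A ∩ S).card : ℝ) := (Finset.mem_filter.1 hS).2
    rw [← Real.exp_log (show (0 : ℝ) < 2 ^ (A ∩ S).card by positivity), Real.log_pow]
    refine Real.exp_le_exp.2 ?_
    nlinarith [Real.log_two_gt_d9]
  have hmoment : ((s : ℝ) / W.card + 1) ^ A.card ≤ Real.exp (T / 18) :=
    calc ((s : ℝ) / W.card + 1) ^ A.card ≤ Real.exp ((s : ℝ) / W.card) ^ A.card :=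
          pow_le_pow_left₀ (by positivity) (Real.add_one_le_exp _) _
      _ = Real.exp (A.card * ((s : ℝ) / W.card)) := (Real.exp_nat_mul _ _).symm
      _ ≤ Real.exp (T / 18) := Real.exp_le_exp.2 (by linarith)
  have hn10 : (n : ℝ) ^ (-10 : ℤ) = Real.exp (-10 * Real.log n) := by
    rw [← Real.rpow_intCast, Real.rpow_def_of_pos (by linarith)]
    congr 1; push_cast; ring
  rw [Finset.card_powersetCard, hn10]
  refine le_of_mul_le_mul_right ?_ (Real.exp_pos (T / 2))
  calc (F.card : ℝ) * Real.exp (T / 2)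
      ≤ ((s : ℝ) / W.card + 1) ^ A.card * (W.card.choose s : ℝ) :=
        hmarkov.trans (Finset.sum_powersetCard_two_pow_card_inter_le hAW hs' hWpos)
    _ ≤ Real.exp (-10 * Real.log n + T / 2) * (W.card.choose s : ℝ) := by
        refine mul_le_mul_of_nonneg_right (hmoment.trans (Real.exp_le_exp.2 ?_))
          (Nat.cast_nonneg _)
        linarith
    _ = Real.exp (-10 * Real.log n) * (W.card.choose s : ℝ) * Real.exp (T / 2) := by
        rw [Real.exp_add]; ring
end

section
/- The sampled residual subgraph has at most n edges (Lemma 3). Let n ≥ 3, let G be a finite simple graph on n vertices, fix an integer k' ≥ 0 and distinct vertices w_1, …, w_{k'} placed in this order at the first k' positions of the ordering, and let the remaining n − k' vertices occupy positions k'+1, …, n in uniformly random order. Let U = U_{k'+1} be the set of uncovered vertices after greedy processes w_1, …, w_{k'}, let G' = G[U] and D = Δ(G'). Assume D ≥ 225·(ln n)^4, set k := ⌊n/(5·√D)⌋, and assume k' < k. Then with probability at least 1 − n^{−9} over the random placement of the last n − k' vertices: every vertex u ∈ U satisfies |N_{G'}(u) ∩ {v_{k'+1}, …, v_k}| ≤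 n/k, and consequently the induced subgraph of G' on {v_{k'+1}, …, v_k} ∩ U has at most n edges. -/
open Finset
open scoped Classical

/-- Fix the values `σ (e i) = w i` of a bijection, let `R` be a set of free positions and `Q ⊆ R`.
Swapping the position of `x` with a free one compares the bijections whose image of `Q` contains
`insert x B` with those whose image of `Q` contains `B`. -/
lemma card_insert_subset_image_mul_sub_le {α β ι : Type*} [Fintype α] [Fintype β]
    [DecidableEq α] [DecidableEq β] (e : ι → α) (w : ι → β) (R Q : Finset α) (he : ∀ i, e i ∉ R)
    (hQR : Q ⊆ R) (B : Finset β) (x : β) (hx : x ∉ B) :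
    #{σ : α ≃ β | (∀ i, σ (e i) = w i) ∧ insert x B ⊆ Q.image σ} * (#R - #B) ≤
      #{σ : α ≃ β | (∀ i, σ (e i) = w i) ∧ B ⊆ Q.image σ} * (#Q - #B) := by
  have hcard : ∀ (σ : α ≃ β) (S : Finset α), B ⊆ S.image σ →
      #(S \ B.image σ.symm) = #S - #B := by
    intro σ S hB
    rw [card_sdiff_of_subset, card_image_of_injective _ σ.symm.injective]
    intro p hp
    obtain ⟨b, hb, rfl⟩ := mem_image.1 hp
    obtain ⟨q, hq, rfl⟩ := mem_image.1 (hB hb)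
    simpa using hq
  have h1 := card_sigma
    ({σ : α ≃ β | (∀ i, σ (e i) = w i) ∧ insert x B ⊆ Q.image σ} : Finset (α ≃ β))
    (fun σ => R \ B.image σ.symm)
  have h2 := card_sigma
    ({σ : α ≃ β | (∀ i, σ (e i) = w i) ∧ B ⊆ Q.image σ} : Finset (α ≃ β))
    (fun σ => Q \ B.image σ.symm)
  rw [sum_const_nat (m := #R - #B)] at h1
  · rw [sum_const_nat (m := #Q - #B)] at h2
    · rw [← h1, ← h2]
      refine card_le_card_of_injOn
        (fun s => ⟨(Equiv.swap (s.1.symm x) s.2).trans s.1, s.1.symm x⟩) ?_ ?_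
      · rintro ⟨σ, p⟩ h
        simp only [coe_sigma, Set.mem_sigma_iff, mem_coe, mem_filter, mem_univ, true_and,
          mem_sdiff, mem_image, not_exists, not_and, insert_subset_iff] at h ⊢
        obtain ⟨⟨hw, ⟨q, hq, hqx⟩, hB⟩, hpR, hpB⟩ := h
        have hqx' : σ.symm x = q := by rw [← hqx]; simp
        rw [hqx']
        have hfix : ∀ b ∈ B, Equiv.swap q p (σ.symm b) = σ.symm b := by
          intro b hb
          refine Equiv.swap_apply_of_ne_of_ne ?_ (hpB b hb)
          rintro h
          apply hx
          rw [← hqx, ← h]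
          simpa using hb
        refine ⟨⟨fun i => ?_, fun b hb => ?_⟩, hq, fun b hb h => ?_⟩
        · rw [Equiv.trans_apply, Equiv.swap_apply_of_ne_of_ne, hw i]
          · rintro rfl
            exact he i (hQR hq)
          · rintro rfl
            exact he i hpR
        · obtain ⟨r, hr, rfl⟩ := mem_image.1 (hB hb)
          have := hfix _ hb
          rw [Equiv.symm_apply_apply] at this
          exact mem_image.2 ⟨r, hr, by rw [Equiv.trans_apply, this]⟩
        · rw [Equiv.symm_trans_apply, Equiv.symm_swap, hfix b hb] at h
          apply hx
          rw [← hqx, ← h]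
          simpa using hb
      · rintro ⟨σ, p⟩ - ⟨τ, r⟩ - h
        simp only [Sigma.mk.injEq, heq_eq_eq] at h
        obtain ⟨h, hq⟩ := h
        have hpr : p = r := by
          have := congrArg (fun ρ : α ≃ β => ρ.symm x) h
          simpa [hq] using this
        subst hpr
        have hστ : σ = τ := by
          ext a
          have := congrArg (fun ρ : α ≃ β => ρ (Equiv.swap (σ.symm x) p a)) h
          simpa [hq] using this
        subst hστ
        rfl
    · intro σ hσ
      exact hcard σ Q (mem_filter.1 hσ).2.2
  · intro σ hσ
    exact hcard σ R
      ((subset_insert x B).trans ((mem_filter.1 hσ).2.2.trans (image_subset_image hQR)))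

lemma card_subset_image_mul_pow_le {α β ι : Type*} [Fintype α] [Fintype β]
    [DecidableEq α] [DecidableEq β] (e : ι → α) (w : ι → β) (R Q : Finset α) (he : ∀ i, e i ∉ R)
    (hQR : Q ⊆ R) (A : Finset β) :
    #{σ : α ≃ β | (∀ i, σ (e i) = w i) ∧ A ⊆ Q.image σ} * #R ^ #A ≤
      #{σ : α ≃ β | ∀ i, σ (e i) = w i} * #Q ^ #A := by
  induction A using Finset.induction_on with
  | empty => simp
  | insert x B hx ih =>
    have hstep := card_insert_subset_image_mul_sub_le e w R Q he hQR B x hx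
    rw [card_insert_of_notMem hx]
    set s := #{σ : α ≃ β | (∀ i, σ (e i) = w i) ∧ insert x B ⊆ Q.image σ} with hs
    set t := #{σ : α ≃ β | (∀ i, σ (e i) = w i) ∧ B ⊆ Q.image σ}
    rcases Nat.eq_zero_or_pos s with h0 | hpos
    · simp [h0]
    obtain ⟨σ, hσ⟩ := card_pos.1 (hs ▸ hpos)
    have hBQ : #B + 1 ≤ #Q := by
      rw [← card_insert_of_notMem hx]
      exact (card_le_card (mem_filter.1 hσ).2.2).trans card_image_le
    have hQR' : #Q ≤ #R := card_le_card hQR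
    have key : s * #R ≤ t * #Q := by
      obtain ⟨c, hc⟩ := Nat.exists_eq_add_of_le hBQ
      obtain ⟨d, hd⟩ := Nat.exists_eq_add_of_le hQR'
      have e1 : #R - #B = c + d + 1 := by omega
      have e2 : #Q - #B = c + 1 := by omega
      rw [e1, e2] at hstep
      refine Nat.le_of_mul_le_mul_right (c := c + d + 1) ?_ (by omega)
      have h3 : #R * (c + 1) ≤ #Q * (c + d + 1) := by
        rw [hd, hc]; nlinarith [Nat.zero_le (#B * d)]
      calc s * #R * (c + d + 1) = s * (c + d + 1) * #R := by ring
        _ ≤ t * (c + 1) * #R := Nat.mul_le_mul_right _ hstep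
        _ = t * (#R * (c + 1)) := by ring
        _ ≤ t * (#Q * (c + d + 1)) := Nat.mul_le_mul_left _ h3
        _ = t * #Q * (c + d + 1) := by ring
    calc s * #R ^ (#B + 1) = s * #R * #R ^ #B := by ring
      _ ≤ t * #Q * #R ^ #B := Nat.mul_le_mul_right _ key
      _ = t * #R ^ #B * #Q := by ring
      _ ≤ _ := Nat.mul_le_mul_right _ ih
      _ = _ := by ring

/-- Union bound over the `a`-subsets of `T`. -/
lemma card_le_card_inter_image_mul_pow_le {α β ι : Type*} [Fintype α] [Fintype β]
    [DecidableEq α] [DecidableEq β] (e : ι → α) (w : ι → β) (R Q : Finset α) (he : ∀ i, e i ∉ R)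
    (hQR : Q ⊆ R) (T : Finset β) (a : ℕ) :
    #{σ : α ≃ β | (∀ i, σ (e i) = w i) ∧ a ≤ #(T ∩ Q.image σ)} * #R ^ a ≤
      (#T).choose a * (#{σ : α ≃ β | ∀ i, σ (e i) = w i} * #Q ^ a) := by
  have hsub : ({σ : α ≃ β | (∀ i, σ (e i) = w i) ∧ a ≤ #(T ∩ Q.image σ)} : Finset (α ≃ β)) ⊆
      (T.powersetCard a).biUnion fun A =>
        {σ : α ≃ β | (∀ i, σ (e i) = w i) ∧ A ⊆ Q.image σ} := by
    intro σ hσ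
    obtain ⟨hw, ha⟩ := (mem_filter.1 hσ).2
    obtain ⟨A, hA, hAa⟩ := exists_subset_card_eq ha
    rw [subset_inter_iff] at hA
    exact mem_biUnion.2 ⟨A, mem_powersetCard.2 ⟨hA.1, hAa⟩, by simp [hw, hA.2]⟩
  calc _ ≤ (∑ A ∈ T.powersetCard a,
        #{σ : α ≃ β | (∀ i, σ (e i) = w i) ∧ A ⊆ Q.image σ}) * #R ^ a :=
      Nat.mul_le_mul_right _ ((card_le_card hsub).trans card_biUnion_le)
    _ = ∑ A ∈ T.powersetCard a,
        #{σ : α ≃ β | (∀ i, σ (e i) = w i) ∧ A ⊆ Q.image σ} * #R ^ a := sum_mul _ _ _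
    _ ≤ ∑ A ∈ T.powersetCard a, #{σ : α ≃ β | ∀ i, σ (e i) = w i} * #Q ^ a := by
      refine sum_le_sum fun A hA => ?_
      rw [← (mem_powersetCard.1 hA).2]
      exact card_subset_image_mul_pow_le e w R Q he hQR A
    _ = _ := by rw [sum_const, card_powersetCard, smul_eq_mul]

lemma two_mul_card_edgeFinset_induce_le {V : Type*} [Fintype V] [DecidableEq V]
    (G : SimpleGraph V) [DecidableRel G.Adj] (S : Finset V)
    [Fintype (G.induce (S : Set V)).edgeSet] (c : ℝ)
    (hc : ∀ v ∈ S, (#(G.neighborFinset v ∩ S) : ℝ) ≤ c) :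
    2 * (#(G.induce (S : Set V)).edgeFinset : ℝ) ≤ #S * c := by
  have h : 2 * #(G.induce (S : Set V)).edgeFinset =
      ∑ v : (S : Set V), (G.induce (S : Set V)).degree v := by
    rw [SimpleGraph.sum_degrees_eq_twice_card_edges]
    congr!
  have h' : 2 * (#(G.induce (S : Set V)).edgeFinset : ℝ) =
      ∑ v : (S : Set V), ((G.induce (S : Set V)).degree v : ℝ) := by exact_mod_cast h
  rw [h']
  have hdeg : ∀ v : (S : Set V), ((G.induce (S : Set V)).degree v : ℝ) ≤ c := by
    intro v
    refine le_trans ?_ (hc v v.2)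
    norm_cast
    rw [← SimpleGraph.card_neighborFinset_eq_degree]
    refine card_le_card_of_injOn Subtype.val ?_ Subtype.val_injective.injOn
    intro u hu
    have hadj : G.Adj v u := by simpa using hu
    exact mem_inter.2 ⟨by simpa using hadj, u.2⟩
  calc _ ≤ ∑ v : (S : Set V), c := sum_le_sum fun v _ => hdeg v
    _ = _ := by simp

lemma choose_mul_pow_le_exp_neg {d a : ℕ} {D q : ℝ} (hD : 0 < D) (hd : (d : ℝ) ≤ D) (hq0 : 0 ≤ q)
    (hq : q ≤ 1 / (5 * √D)) (ha : 5 * √D ≤ a) :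
    (d.choose a : ℝ) * q ^ a ≤ Real.exp (-a) := by
  have hs : 0 < √D := Real.sqrt_pos.2 hD
  have hss : √D * √D = D := Real.mul_self_sqrt hD.le
  have ha0 : (0 : ℝ) < a := by linarith
  have hfac : (0 : ℝ) < a.factorial := by exact_mod_cast a.factorial_pos
  have hexp : (a : ℝ) ^ a / a.factorial ≤ Real.exp 1 ^ a := by
    rw [← Real.exp_nat_mul, mul_one]
    exact Real.pow_div_factorial_le_exp _ ha0.le a
  have hbase : Real.exp 1 * (D * q / a) ≤ Real.exp (-1) := by
    have h1 : D * q / a ≤ 1 / 25 := by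
      rw [div_le_iff₀ ha0]
      calc D * q ≤ D * (1 / (5 * √D)) := by gcongr
        _ = √D / 5 := by rw [← hss]; field_simp; simp
        _ ≤ 1 / 25 * a := by linarith
    have h2 : Real.exp 1 * Real.exp 1 ≤ 25 := by
      nlinarith [Real.exp_one_lt_three, Real.exp_pos 1]
    rw [Real.exp_neg, ← one_div, le_div_iff₀ (Real.exp_pos 1)]
    nlinarith [mul_pos (Real.exp_pos 1) (Real.exp_pos 1)]
  calc (d.choose a : ℝ) * q ^ a ≤ (d : ℝ) ^ a / a.factorial * q ^ a := by
        gcongr; exact Nat.choose_le_pow_div a d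
    _ ≤ D ^ a / a.factorial * q ^ a := by gcongr
    _ = (a : ℝ) ^ a / a.factorial * (D * q / a) ^ a := by
      rw [div_pow, mul_pow]; field_simp
    _ ≤ Real.exp 1 ^ a * (D * q / a) ^ a := by gcongr
    _ = (Real.exp 1 * (D * q / a)) ^ a := (mul_pow _ _ _).symm
    _ ≤ Real.exp (-1) ^ a := by gcongr
    _ = Real.exp (-a) := by rw [← Real.exp_nat_mul]; ring_nf

/-- **The sampled residual subgraph has at most `n` edges.** Fix the first `k'`
positions of the ordering to be the distinct vertices `w_1, …, w_{k'}`, let `U`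
be the uncovered set after greedy processes them, `G' = G[U]`, `D = Δ(G')`, and
`k = ⌊n / (5·√D)⌋` with `D ≥ 225·(ln n)⁴` and `k' < k`. Then, with probability at
least `1 - n ^ (-9)` over a uniformly random placement of the remaining vertices
at positions `k'+1, …, n`, every `u ∈ U` has at most `n/k` neighbors of `G'`
among `{v_{k'+1}, …, v_k}`, and consequently the subgraph of `G'` induced by
`{v_{k'+1}, …, v_k} ∩ U` has at most `n` edges. -/
theorem sampled_residual_subgraph_few_edges
    {V : Type*} [Fintype V] [DecidableEq V] {n : ℕ} (hn : 3 ≤ n)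
    (hcard : Fintype.card V = n)
    (G : SimpleGraph V) [DecidableRel G.Adj]
    (k' : ℕ) (hk'n : k' ≤ n) (w : Fin k' ↪ V)
    (U : Finset V) (hU : U = (greedyStep G (∅, Finset.univ) (List.ofFn ⇑w)).2)
    (D : ℕ) (hD : D = maxDegOn G U)
    (hDbig : 225 * (Real.log n) ^ 4 ≤ (D : ℝ))
    (k : ℕ) (hk : k = ⌊(n : ℝ) / (5 * Real.sqrt D)⌋₊)
    (hk'k : k' < k) :
    (1 - (n : ℝ) ^ (-9 : ℤ)) *
        ((Finset.univ.filter (fun σ : Fin n ≃ V =>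
          ∀ i : Fin k', σ (Fin.castLE hk'n i) = w i)).card : ℝ) ≤
      ((Finset.univ.filter (fun σ : Fin n ≃ V =>
          (∀ i : Fin k', σ (Fin.castLE hk'n i) = w i) ∧
          (∀ u ∈ U,
            ((G.neighborFinset u ∩ U ∩
                (Finset.univ.filter
                  (fun i : Fin n => k' ≤ (i : ℕ) ∧ (i : ℕ) < k)).image σ).card : ℝ)
              ≤ (n : ℝ) / (k : ℝ)) ∧
          ((SimpleGraph.induce
              (↑(((Finset.univ.filter
                    (fun i : Fin n => k' ≤ (i : ℕ) ∧ (i : ℕ) < k)).image σ) ∩ U) : Set V)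
              G).edgeFinset.card ≤ n))).card : ℝ) := by
  have hn0 : (0 : ℝ) < n := by positivity
  have hlog : 1 ≤ Real.log n := by
    rw [Real.le_log_iff_exp_le hn0]
    exact Real.exp_one_lt_three.le.trans (by exact_mod_cast hn)
  have hDpos : (0 : ℝ) < D := lt_of_lt_of_le (by positivity) hDbig
  have hsqrt : 15 * Real.log n ^ 2 ≤ √D := by
    apply Real.le_sqrt_of_sq_le
    linarith [show (15 * Real.log n ^ 2) ^ 2 = 225 * Real.log n ^ 4 by ring]
  have hsqrt15 : 15 ≤ √D := by nlinarith
  have hk0 : (0 : ℝ) < k := by exact_mod_cast (Nat.zero_le k').trans_lt hk'k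
  have hkle : (k : ℝ) ≤ n / (5 * √D) := by
    rw [hk]; exact Nat.floor_le (by positivity)
  have hkn' : (k : ℝ) ≤ n := hkle.trans (div_le_self hn0.le (by linarith))
  have hkn : k ≤ n := by exact_mod_cast hkn'
  have hthr : 5 * √D ≤ n / k := by
    rw [le_div_iff₀ hk0]
    rw [le_div_iff₀ (by positivity)] at hkle
    linarith
  set Q : Finset (Fin n) := {i : Fin n | k' ≤ (i : ℕ) ∧ (i : ℕ) < k} with hQ
  set R : Finset (Fin n) := {i : Fin n | k' ≤ (i : ℕ)} with hR
  have hQR : Q ⊆ R := fun i hi => by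
    simp only [hQ, hR, mem_filter, mem_univ, true_and] at hi ⊢
    exact hi.1
  have he : ∀ i : Fin k', Fin.castLE hk'n i ∉ R := fun i => by simp [hR]
  have hQcard : #Q = k - k' := by
    rw [← Nat.card_Ico, ← card_map Fin.valEmbedding]
    congr 1
    ext j
    simp only [hQ, mem_map, mem_filter, mem_univ, true_and, Fin.valEmbedding_apply, mem_Ico]
    exact ⟨by rintro ⟨i, h, rfl⟩; exact h, fun h => ⟨⟨j, by omega⟩, h, rfl⟩⟩
  have hRcard : #R = n - k' := by
    rw [← Nat.card_Ico, ← card_map Fin.valEmbedding]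
    congr 1
    ext j
    simp only [hR, mem_map, mem_filter, mem_univ, true_and, Fin.valEmbedding_apply, mem_Ico]
    exact ⟨by rintro ⟨i, h, rfl⟩; exact ⟨h, i.2⟩, fun h => ⟨⟨j, h.2⟩, h.1, rfl⟩⟩
  have hRpos : (0 : ℝ) < #R := by rw [hRcard]; exact_mod_cast (by omega : 0 < n - k')
  have hratio : (#Q : ℝ) / #R ≤ 1 / (5 * √D) := by
    have h1 : (#Q : ℝ) / #R ≤ k / n := by
      rw [div_le_div_iff₀ hRpos hn0, hQcard, hRcard, Nat.cast_sub hk'k.le, Nat.cast_sub hk'n]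
      nlinarith [mul_nonneg (Nat.cast_nonneg (α := ℝ) k') (sub_nonneg.2 hkn')]
    refine h1.trans ?_
    rw [div_le_div_iff₀ hn0 (by positivity), one_mul]
    rwa [le_div_iff₀ (by positivity)] at hkle
  set a : ℕ := ⌊(n : ℝ) / k⌋₊ + 1 with ha
  have hna : (n : ℝ) / k < a := by rw [ha]; exact_mod_cast Nat.lt_floor_add_one _
  have ha5 : 5 * √D ≤ a := hthr.trans hna.le
  set Ω : Finset (Fin n ≃ V) := {σ : Fin n ≃ V | ∀ i : Fin k', σ (Fin.castLE hk'n i) = w i}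
  let bad : V → Finset (Fin n ≃ V) := fun u =>
    {σ : Fin n ≃ V | (∀ i : Fin k', σ (Fin.castLE hk'n i) = w i) ∧
      a ≤ #(G.neighborFinset u ∩ U ∩ Q.image σ)}
  have hbad : ∀ u ∈ U, (#(bad u) : ℝ) ≤ (n : ℝ) ^ (-10 : ℤ) * #Ω := by
    intro u hu
    have hdeg : (#(G.neighborFinset u ∩ U) : ℝ) ≤ D := by
      rw [hD]
      exact_mod_cast le_sup (f := fun v => #(G.neighborFinset v ∩ U)) hu
    have hcount : (#(bad u) : ℝ) * #R ^ a ≤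
        (#(G.neighborFinset u ∩ U)).choose a * (#Ω * #Q ^ a) := by
      have h := card_le_card_inter_image_mul_pow_le (Fin.castLE hk'n) w R Q he hQR
        (G.neighborFinset u ∩ U) a
      have h' : #(bad u) * #R ^ a ≤ (#(G.neighborFinset u ∩ U)).choose a * (#Ω * #Q ^ a) := by
        convert h
      exact_mod_cast h'
    have hexp : Real.exp (-a) ≤ (n : ℝ) ^ (-10 : ℤ) := by
      rw [← Real.log_le_log_iff (Real.exp_pos _) (by positivity), Real.log_exp, Real.log_zpow]
      push_cast
      nlinarith
    have htail := choose_mul_pow_le_exp_neg hDpos hdeg (by positivity) hratio ha5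
    calc (#(bad u) : ℝ) ≤ (#(G.neighborFinset u ∩ U)).choose a * (#Ω * #Q ^ a) / #R ^ a := by
          rwa [le_div_iff₀ (by positivity)]
      _ = (#(G.neighborFinset u ∩ U)).choose a * (#Q / #R : ℝ) ^ a * #Ω := by
        rw [div_pow]; ring
      _ ≤ _ := by gcongr; exact htail.trans hexp
  have hunion : (#(U.biUnion bad) : ℝ) ≤ (n : ℝ) ^ (-9 : ℤ) * #Ω := by
    have hUn : (#U : ℝ) ≤ n := by rw [← hcard]; exact_mod_cast card_le_univ U
    calc (#(U.biUnion bad) : ℝ) ≤ ∑ u ∈ U, (#(bad u) : ℝ) := by exact_mod_cast card_biUnion_le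
      _ ≤ ∑ u ∈ U, (n : ℝ) ^ (-10 : ℤ) * #Ω := sum_le_sum hbad
      _ = #U * ((n : ℝ) ^ (-10 : ℤ) * #Ω) := by rw [sum_const, nsmul_eq_mul]
      _ ≤ n * ((n : ℝ) ^ (-10 : ℤ) * #Ω) := by gcongr
      _ = _ := by
        rw [← mul_assoc, ← zpow_one_add₀ hn0.ne']; norm_num
  have hsdiff : (#Ω : ℝ) - #(U.biUnion bad) ≤ #(Ω \ U.biUnion bad) := by
    have := le_card_sdiff (U.biUnion bad) Ω
    rw [sub_le_iff_le_add]
    exact_mod_cast (by omega : #Ω ≤ #(Ω \ U.biUnion bad) + #(U.biUnion bad))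
  refine le_trans (by linarith) (hsdiff.trans (Nat.cast_le.2 (card_le_card fun σ hσ => ?_)))
  rw [mem_sdiff, mem_biUnion] at hσ
  obtain ⟨hσ, hgood⟩ := hσ
  have hw : ∀ i : Fin k', σ (Fin.castLE hk'n i) = w i := (mem_filter.1 hσ).2
  have hnbr : ∀ u ∈ U, (#(G.neighborFinset u ∩ U ∩ Q.image σ) : ℝ) ≤ n / k := by
    intro u hu
    by_contra! h
    refine hgood ⟨u, hu, mem_filter.2 ⟨mem_univ _, hw, ?_⟩⟩
    exact Nat.succ_le_of_lt ((Nat.floor_lt (by positivity)).2 h)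
  refine mem_filter.2 ⟨mem_univ _, hw, hnbr, ?_⟩
  have hedge := two_mul_card_edgeFinset_induce_le G (Q.image σ ∩ U) (n / k) fun v hv => by
    rw [inter_comm (Q.image σ), ← inter_assoc]
    exact hnbr v (mem_inter.1 hv).2
  have hS : (#(Q.image σ ∩ U) : ℝ) ≤ k := by
    exact_mod_cast (card_le_card inter_subset_left).trans
      (card_image_le.trans (hQcard.le.trans (Nat.sub_le _ _)))
  have hSn : (#(Q.image σ ∩ U) : ℝ) * (n / k) ≤ n := by
    calc _ ≤ (k : ℝ) * (n / k) := by gcongr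
      _ = n := by field_simp
  rw [← Nat.cast_le (α := ℝ)]
  refine le_trans ?_ (show (n : ℝ) / 2 ≤ n by linarith)
  rw [le_div_iff₀ two_pos, mul_comm]
  exact hedge.trans hSn
end
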